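/- Let k ≥ 1 and m ≥ 0, let I be the ideal (ζ̄_{m+1}, …, ζ̄_{m+k}) of A⟨k⟩, and for each natural number d let H_d denote the F₂-subspace of A⟨k⟩ consisting of weighted-homogeneous polynomials of weighted degree d, and let h(d) be the F₂-dimension of H_d/(H_d ∩ I). Then h(d) = 0 for all d > 2(2^m − 1)(2^k − 1), and in the polynomial ring ℤ[t] one has the identity (∑_d h(d) t^d) · ∏_{i=1}^{k} (1 − t^{2^i − 1}) = ∏_{i=1}^{k} (1 − t^{2^{m+i} − 1}). -/

import Mathlib

open MvPolynomial

/-- The dual Steenrod algebra `A = F₂[ξ₁, ξ₂, …]`; the variable `X i` represents `ξ_{i+1}`. -/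
noncomputable abbrev DualSteenrod : Type := MvPolynomial ℕ (ZMod 2)

/-- The conjugate classes, via Milnor's recursion
`ζ_n = ∑_{i=1}^{n} ξ_i^{2^{n−i}} ζ_{n−i}` (with `ζ_0 = 1`). -/
noncomputable def zeta : ℕ → DualSteenrod
  | 0 => 1
  | (n+1) => ∑ i ∈ Finset.range (n+1), (X i) ^ (2^(n-i)) * zeta (n-i)
  decreasing_by omega

/-- The projection `A → A⟨k⟩ = F₂[ξ₁, …, ξ_k]`, killing `ξ_i` for `i > k`.
In `MvPolynomial (Fin k) (ZMod 2)`, the variable `X i` represents `ξ_{i+1}`. -/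
noncomputable def proj (k : ℕ) :
    DualSteenrod →ₐ[ZMod 2] MvPolynomial (Fin k) (ZMod 2) :=
  aeval (fun i => if h : i < k then X (⟨i, h⟩ : Fin k) else 0)

/-- `ζ̄_n`, the image of `ζ_n` in `A⟨k⟩`. -/
noncomputable def zetaBar (k n : ℕ) : MvPolynomial (Fin k) (ZMod 2) :=
  proj k (zeta n)

section HilbertSeries

attribute [local instance] MvPolynomial.weightedGradedAlgebra

variable {K σ : Type*} [Field K]

/-- The Hilbert series of `K[σ] ⧸ J`, where `K[σ]` is graded by the weight `w`. -/
noncomputable def hilbertSeries (w : σ → ℕ) (J : Ideal (MvPolynomial σ K)) : PowerSeries ℤ :=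
  PowerSeries.mk fun d => (Module.finrank K
    ((weightedHomogeneousSubmodule K w d).map (Ideal.Quotient.mkₐ K J).toLinearMap) : ℤ)

/-- The coefficientwise order on integral power series. -/
def CoeffLE (f g : PowerSeries ℤ) : Prop := ∀ d, PowerSeries.coeff d f ≤ PowerSeries.coeff d g

lemma CoeffLE.trans {f g h : PowerSeries ℤ} (h₁ : CoeffLE f g) (h₂ : CoeffLE g h) :
    CoeffLE f h := fun d => (h₁ d).trans (h₂ d)

lemma CoeffLE.refl (f : PowerSeries ℤ) : CoeffLE f f := fun _ => le_rfl

lemma CoeffLE.add {f g f' g' : PowerSeries ℤ} (h₁ : CoeffLE f g) (h₂ : CoeffLE f' g') :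
    CoeffLE (f + f') (g + g') := fun d => by
  simpa using add_le_add (h₁ d) (h₂ d)

lemma CoeffLE.mul_right {f g p : PowerSeries ℤ} (h : CoeffLE f g) (hp : CoeffLE 0 p) :
    CoeffLE (f * p) (g * p) := fun d => by
  rw [PowerSeries.coeff_mul, PowerSeries.coeff_mul]
  exact Finset.sum_le_sum fun x _ => mul_le_mul_of_nonneg_right (h _) (by simpa using hp x.2)

lemma CoeffLE.mul_left {f g p : PowerSeries ℤ} (h : CoeffLE f g) (hp : CoeffLE 0 p) :
    CoeffLE (p * f) (p * g) := by
  rw [mul_comm p, mul_comm p]; exact h.mul_right hp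

lemma CoeffLE.zero_X_pow (n : ℕ) : CoeffLE 0 (PowerSeries.X ^ n) := fun d => by
  rw [PowerSeries.coeff_X_pow]; split_ifs <;> simp

lemma CoeffLE.zero_mul {f g : PowerSeries ℤ} (hf : CoeffLE 0 f) (hg : CoeffLE 0 g) :
    CoeffLE 0 (f * g) := by
  simpa using hf.mul_right hg

/-- Multiplication by a series with constant term `1` and nonnegative coefficients reflects
equality of comparable series. -/
lemma CoeffLE.eq_of_mul {f g p : PowerSeries ℤ} (h : CoeffLE f g) (hp : CoeffLE 0 p)
    (h1 : PowerSeries.coeff 0 p = 1) (hmul : CoeffLE (g * p) (f * p)) : f = g := by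
  ext d
  refine le_antisymm (h d) ?_
  have h2 := hmul d
  rw [PowerSeries.coeff_mul, PowerSeries.coeff_mul, ← sub_nonneg, ← Finset.sum_sub_distrib] at h2
  have hmem : (d, 0) ∈ Finset.HasAntidiagonal.antidiagonal d := by simp
  rw [← Finset.add_sum_erase _ _ hmem] at h2
  have h3 : ∑ x ∈ (Finset.HasAntidiagonal.antidiagonal d).erase (d, 0),
      (PowerSeries.coeff x.1 f * PowerSeries.coeff x.2 p -
        PowerSeries.coeff x.1 g * PowerSeries.coeff x.2 p) ≤ 0 := by
    refine Finset.sum_nonpos fun x _ => ?_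
    rw [sub_nonpos]
    exact mul_le_mul_of_nonneg_right (h _) (by simpa using hp x.2)
  simp only [h1, mul_one] at h2
  linarith

lemma finiteDimensional_weightedHomogeneousSubmodule [Finite σ] {w : σ → ℕ} (hw : ∀ i, w i ≠ 0)
    (d : ℕ) : FiniteDimensional K (weightedHomogeneousSubmodule K w d) :=
  Module.Finite.iff_fg.mpr (weightedHomogeneousSubmodule_fg (R := K) w hw d)

theorem hilbertSeries_coeffLE_add [Finite σ] {w : σ → ℕ} (hw : ∀ i, w i ≠ 0)
    {J L J' : Ideal (MvPolynomial σ K)} {c : MvPolynomial σ K} {e : ℕ}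
    (hJ : J.IsHomogeneous (weightedHomogeneousSubmodule K w))
    (hc : IsWeightedHomogeneous w c e)
    (hJL : J ≤ L) (hL : L ≤ J ⊔ Ideal.span {c}) (hJ' : ∀ f ∈ J', c * f ∈ J) :
    CoeffLE (hilbertSeries w J) (hilbertSeries w L + PowerSeries.X ^ e * hilbertSeries w J') := by
  intro d
  have := fun n => finiteDimensional_weightedHomogeneousSubmodule (K := K) hw n
  rw [map_add, PowerSeries.coeff_X_pow_mul']
  simp only [hilbertSeries, PowerSeries.coeff_mk]
  set P := (weightedHomogeneousSubmodule K w d).map (Ideal.Quotient.mkₐ K J).toLinearMap with hP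
  let φ := (Ideal.Quotient.factorₐ K hJL).toLinearMap
  have hrk := (φ.domRestrict P).finrank_range_add_finrank_ker
  have hmap : P.map φ = (weightedHomogeneousSubmodule K w d).map
      (Ideal.Quotient.mkₐ K L).toLinearMap := by
    rw [hP, ← Submodule.map_comp]; rfl
  rw [LinearMap.range_domRestrict, hmap] at hrk
  have hdec : ∀ f ∈ weightedHomogeneousSubmodule K w d, f ∈ L → ∃ g : MvPolynomial σ K,
      f - (DirectSum.decompose (weightedHomogeneousSubmodule K w) (c * g) d : MvPolynomial σ K)
        ∈ J := by
    intro f hf hfL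
    obtain ⟨j, hj, y, hy, rfl⟩ := Submodule.mem_sup.mp (hL hfL)
    obtain ⟨g, rfl⟩ := Ideal.mem_span_singleton'.mp hy
    refine ⟨g, ?_⟩
    have := hJ d hj
    rw [← DirectSum.decompose_of_mem_same _ hf, DirectSum.decompose_add, DirectSum.add_apply,
      Submodule.coe_add, mul_comm g c, add_sub_cancel_right]
    exact this
  have hker : ∀ x : P, x ∈ LinearMap.ker (φ.domRestrict P) → ∃ g : MvPolynomial σ K,
      (x : MvPolynomial σ K ⧸ J) = Ideal.Quotient.mk J
      (DirectSum.decompose (weightedHomogeneousSubmodule K w) (c * g) d : MvPolynomial σ K) := by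
    rintro ⟨_, f, hf, rfl⟩ hx
    obtain ⟨g, hg⟩ := hdec f hf (Ideal.Quotient.eq_zero_iff_mem.mp hx)
    exact ⟨g, Ideal.Quotient.eq.mpr hg⟩
  split_ifs with hed
  · let ψ : (MvPolynomial σ K ⧸ J') →ₗ[K] (MvPolynomial σ K ⧸ J) :=
      (Submodule.mapQ J' J (LinearMap.mulLeft (MvPolynomial σ K) c) hJ').restrictScalars K
    have hle : (LinearMap.ker (φ.domRestrict P)).map P.subtype ≤
        ((weightedHomogeneousSubmodule K w (d - e)).map
          (Ideal.Quotient.mkₐ K J').toLinearMap).map ψ := by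
      rintro _ ⟨x, hx, rfl⟩
      obtain ⟨g, hg⟩ := hker x hx
      rw [DirectSum.coe_decompose_mul_of_left_mem_of_le _ hc hed] at hg
      exact ⟨_, ⟨_, SetLike.coe_mem _, rfl⟩, hg.symm⟩
    have h1 := Submodule.finrank_mono hle
    rw [Submodule.finrank_map_subtype_eq] at h1
    have h2 := Submodule.finrank_map_le ψ ((weightedHomogeneousSubmodule K w (d - e)).map
      (Ideal.Quotient.mkₐ K J').toLinearMap)
    omega
  · have : LinearMap.ker (φ.domRestrict P) = ⊥ := by
      rw [eq_bot_iff]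
      intro x hx
      obtain ⟨g, hg⟩ := hker x hx
      rw [DirectSum.coe_decompose_mul_of_left_mem_of_not_le _ hc hed, map_zero] at hg
      exact Subtype.ext hg
    rw [this, finrank_bot] at hrk
    omega

theorem hilbertSeries_coeffLE_of_algHom {τ : Type*} [Finite τ] {v : τ → ℕ} (hv : ∀ i, v i ≠ 0)
    {w : σ → ℕ} {J' : Ideal (MvPolynomial τ K)} {J : Ideal (MvPolynomial σ K)}
    (φ : MvPolynomial τ K →ₐ[K] MvPolynomial σ K) (hφ : J' ≤ J.comap φ)
    (hsurj : ∀ d, ∀ f, IsWeightedHomogeneous w f d →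
      ∃ g, IsWeightedHomogeneous v g d ∧ f - φ g ∈ J) :
    CoeffLE (hilbertSeries w J) (hilbertSeries v J') := by
  intro d
  have := finiteDimensional_weightedHomogeneousSubmodule (K := K) hv d
  simp only [hilbertSeries, PowerSeries.coeff_mk, Nat.cast_le]
  have hle : (weightedHomogeneousSubmodule K w d).map (Ideal.Quotient.mkₐ K J).toLinearMap ≤
      ((weightedHomogeneousSubmodule K v d).map (Ideal.Quotient.mkₐ K J').toLinearMap).map
        (Ideal.quotientMapₐ J φ hφ).toLinearMap := by
    rintro _ ⟨f, hf, rfl⟩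
    obtain ⟨g, hg, hfg⟩ := hsurj d f hf
    exact ⟨_, ⟨g, hg, rfl⟩, (Ideal.Quotient.eq.mpr hfg).symm⟩
  exact (Submodule.finrank_mono hle).trans (Submodule.finrank_map_le _ _)

theorem hilbertSeries_top (w : σ → ℕ) :
    hilbertSeries w (⊤ : Ideal (MvPolynomial σ K)) = 0 := by
  ext d
  have : Subsingleton (MvPolynomial σ K ⧸ (⊤ : Ideal (MvPolynomial σ K))) :=
    Ideal.Quotient.subsingleton_iff.mpr rfl
  simp only [hilbertSeries, PowerSeries.coeff_mk, map_zero, Nat.cast_eq_zero]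
  exact Module.finrank_zero_of_subsingleton

theorem hilbertSeries_coeffLE_one {w : σ → ℕ} {J : Ideal (MvPolynomial σ K)}
    (hJ : ∀ i, X i ∈ J) : CoeffLE (hilbertSeries w J) 1 := by
  have hmk : ∀ f : MvPolynomial σ K, Ideal.Quotient.mkₐ K J f = f.coeff 0 • 1 := by
    intro f
    have h : idealOfVars σ K ≤ J := Ideal.span_le.mpr (Set.range_subset_iff.mpr hJ)
    rw [← map_one (Ideal.Quotient.mkₐ K J), ← map_smul]
    refine Ideal.Quotient.eq.mpr (h ?_)
    rw [idealOfVars, ← Set.image_univ, mem_ideal_span_X_image]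
    intro n hn
    by_contra! hcon
    have h0 : n = 0 := Finsupp.ext fun i => hcon i trivial
    simp [h0, coeff_smul] at hn
  intro d
  simp only [hilbertSeries, PowerSeries.coeff_mk, PowerSeries.coeff_one]
  split_ifs with hd
  · have hle : (weightedHomogeneousSubmodule K w d).map (Ideal.Quotient.mkₐ K J).toLinearMap ≤
        Submodule.span K {1} := by
      rintro _ ⟨f, -, rfl⟩
      exact Submodule.mem_span_singleton.mpr ⟨_, (hmk f).symm⟩
    exact_mod_cast (Submodule.finrank_mono hle).trans ((finrank_span_le_card {1}).trans (by simp))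
  · have h0 : (weightedHomogeneousSubmodule K w d).map (Ideal.Quotient.mkₐ K J).toLinearMap
        = ⊥ := by
      rw [eq_bot_iff]
      rintro _ ⟨f, hf, rfl⟩
      have : f.coeff 0 = 0 := IsWeightedHomogeneous.coeff_eq_zero hf 0 (by simpa using Ne.symm hd)
      exact (hmk f).trans (by rw [this, zero_smul])
    rw [h0, finrank_bot, Nat.cast_zero]

/-- The power series `1 / (1 - X ^ e)`. -/
noncomputable def geomSeries (e : ℕ) : PowerSeries ℤ :=
  PowerSeries.mk fun n => if e ∣ n then 1 else 0

lemma geomSeries_mul {e : ℕ} (he : e ≠ 0) : geomSeries e * (1 - PowerSeries.X ^ e) = 1 := by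
  ext n
  rw [mul_sub, mul_one, map_sub, PowerSeries.coeff_mul_X_pow', geomSeries, PowerSeries.coeff_mk,
    PowerSeries.coeff_mk, PowerSeries.coeff_one]
  rcases eq_or_ne n 0 with rfl | hn
  · simp [he]
  · by_cases h : e ≤ n
    · have : (e ∣ n ∨ n ≤ e) ↔ e ∣ n :=
        ⟨fun h' => h'.elim id fun h2 => le_antisymm h h2 ▸ dvd_rfl, Or.inl⟩
      simp [h, hn, Nat.dvd_sub_self_right, this]
    · simp [h, hn, mt (Nat.le_of_dvd (Nat.pos_of_ne_zero hn)) h]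

lemma zero_coeffLE_geomSeries (e : ℕ) : CoeffLE 0 (geomSeries e) := fun n => by
  rw [geomSeries, PowerSeries.coeff_mk]; split_ifs <;> simp

lemma zero_coeffLE_prod_geomSeries {ι : Type*} (s : Finset ι) (e : ι → ℕ) :
    CoeffLE 0 (∏ i ∈ s, geomSeries (e i)) := by
  classical
  induction s using Finset.induction_on with
  | empty => intro n; rw [Finset.prod_empty, PowerSeries.coeff_one]; split_ifs <;> simp
  | insert a s ha ih => rw [Finset.prod_insert ha]; exact (zero_coeffLE_geomSeries _).zero_mul ih

lemma prod_geomSeries_mul {ι : Type*} (s : Finset ι) {e : ι → ℕ} (he : ∀ i, e i ≠ 0) :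
    (∏ i ∈ s, geomSeries (e i)) * ∏ i ∈ s, (1 - PowerSeries.X ^ e i) = 1 := by
  rw [← Finset.prod_mul_distrib]
  exact Finset.prod_eq_one fun i _ => geomSeries_mul (he i)

lemma coeff_zero_prod_geomSeries {ι : Type*} (s : Finset ι) (e : ι → ℕ) :
    PowerSeries.coeff 0 (∏ i ∈ s, geomSeries (e i)) = 1 := by
  rw [PowerSeries.coeff_zero_eq_constantCoeff_apply, map_prod]
  exact Finset.prod_eq_one fun i _ => by
    rw [← PowerSeries.coeff_zero_eq_constantCoeff_apply, geomSeries]; simp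

theorem prod_geomSeries_coeffLE_hilbertSeries_bot [Fintype σ] {w : σ → ℕ} (hw : ∀ i, w i ≠ 0) :
    CoeffLE (∏ i, geomSeries (w i)) (hilbertSeries w (⊥ : Ideal (MvPolynomial σ K))) := by
  classical
  intro d
  have := Set.Finite.to_subtype (Finsupp.finite_of_nat_weight_eq w hw d)
  have hfr : Module.finrank K ((weightedHomogeneousSubmodule K w d).map
      (Ideal.Quotient.mkₐ K (⊥ : Ideal (MvPolynomial σ K))).toLinearMap) =
      Nat.card {n : σ →₀ ℕ | Finsupp.weight w n = d} := by
    have hinj : Function.Injective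
        (Ideal.Quotient.mkₐ K (⊥ : Ideal (MvPolynomial σ K))).toLinearMap :=
      fun x y h => sub_eq_zero.mp (Ideal.mem_bot.mp (Ideal.Quotient.eq.mp h))
    rw [← (Submodule.equivMapOfInjective _ hinj _).finrank_eq,
      weightedHomogeneousSubmodule_eq_finsupp_supported]
    exact Module.finrank_eq_nat_card_basis (basisRestrictSupport K _)
  rw [hilbertSeries, PowerSeries.coeff_mk, hfr, PowerSeries.coeff_prod]
  simp only [geomSeries, PowerSeries.coeff_mk, Finset.prod_boole]
  have hcount := Finset.sum_boole (R := ℤ) (fun l : σ →₀ ℕ => ∀ i ∈ Finset.univ, w i ∣ l i)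
    (Finset.univ.finsuppAntidiag d)
  refine le_of_eq_of_le (Eq.trans ?_ hcount) ?_
  · congr!
  rw [Nat.cast_le, ← Set.ncard_coe_finset, Nat.card_coe_set_eq]
  have hdvd : ∀ l ∈ {l ∈ (Finset.univ : Finset σ).finsuppAntidiag d |
      ∀ i ∈ Finset.univ, w i ∣ l i}, ∀ i,
      l i / w i * w i = l i := fun l hl i =>
    Nat.div_mul_cancel ((Finset.mem_filter.mp hl).2 i (Finset.mem_univ i))
  refine Set.ncard_le_ncard_of_injOn
    (fun l => Finsupp.equivFunOnFinite.symm fun i => l i / w i) ?_ ?_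
    (Finsupp.finite_of_nat_weight_eq w hw d)
  · intro l hl
    have hsum := (Finset.mem_finsuppAntidiag.mp (Finset.mem_filter.mp hl).1).1
    simp [Finsupp.weight_apply, Finsupp.sum_fintype, hdvd l hl, hsum]
  · intro l hl l' hl' h
    ext i
    rw [← hdvd l hl i, ← hdvd l' hl' i, show l i / w i = l' i / w i from DFunLike.congr_fun h i]

theorem hilbertSeries_coeffLE_mul_geomSeries [Finite σ] {w : σ → ℕ} (hw : ∀ i, w i ≠ 0)
    {J : Ideal (MvPolynomial σ K)} {c : MvPolynomial σ K} {e : ℕ} (he : e ≠ 0)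
    (hJ : J.IsHomogeneous (weightedHomogeneousSubmodule K w))
    (hc : IsWeightedHomogeneous w c e) :
    CoeffLE (hilbertSeries w J) (hilbertSeries w (J ⊔ Ideal.span {c}) * geomSeries e) := by
  have h := hilbertSeries_coeffLE_add hw hJ hc le_sup_left le_rfl fun f hf => J.mul_mem_left c hf
  have h' : CoeffLE (hilbertSeries w J * (1 - PowerSeries.X ^ e))
      (hilbertSeries w (J ⊔ Ideal.span {c})) := fun d => by
    have := h d
    rw [map_add] at this
    rw [mul_sub, mul_one, map_sub, mul_comm]
    linarith
  have := h'.mul_right (zero_coeffLE_geomSeries e)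
  rwa [mul_assoc, mul_comm _ (geomSeries e), geomSeries_mul he, mul_one] at this

lemma isHomogeneous_span_image {ι : Type*} {w : σ → ℕ} {c : ι → MvPolynomial σ K} {e : ι → ℕ}
    (hc : ∀ i, IsWeightedHomogeneous w (c i) (e i)) (s : Set ι) :
    (Ideal.span (c '' s)).IsHomogeneous (weightedHomogeneousSubmodule K w) := by
  refine Ideal.homogeneous_span _ _ ?_
  rintro _ ⟨i, -, rfl⟩
  exact ⟨e i, hc i⟩

theorem hilbertSeries_bot_coeffLE [Finite σ] {ι : Type*} {w : σ → ℕ} (hw : ∀ i, w i ≠ 0)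
    {c : ι → MvPolynomial σ K} {e : ι → ℕ} (he : ∀ i, e i ≠ 0)
    (hc : ∀ i, IsWeightedHomogeneous w (c i) (e i)) (s : Finset ι) :
    CoeffLE (hilbertSeries w (⊥ : Ideal (MvPolynomial σ K)))
      (hilbertSeries w (Ideal.span (c '' s)) * ∏ i ∈ s, geomSeries (e i)) := by
  classical
  induction s using Finset.induction_on with
  | empty => simpa using CoeffLE.refl _
  | insert a s ha ih =>
    refine ih.trans ?_
    rw [Finset.prod_insert ha, ← mul_assoc, Finset.coe_insert, Set.image_insert_eq,
      Ideal.span_insert, sup_comm]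
    exact (hilbertSeries_coeffLE_mul_geomSeries hw (he a) (isHomogeneous_span_image hc _)
      (hc a)).mul_right (zero_coeffLE_prod_geomSeries _ _)

/-- Suppose the Hilbert series of the quotient by homogeneous elements is bounded by the value it
would take for a regular sequence. Then it is equal to that value. -/
theorem hilbertSeries_eq_of_coeffLE [Fintype σ] {ι : Type*} {w : σ → ℕ} (hw : ∀ i, w i ≠ 0)
    {c : ι → MvPolynomial σ K} {e : ι → ℕ} (he : ∀ i, e i ≠ 0)
    (hc : ∀ i, IsWeightedHomogeneous w (c i) (e i)) (s : Finset ι) {G : PowerSeries ℤ}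
    (hG : G * ∏ i, (1 - PowerSeries.X ^ w i) = ∏ i ∈ s, (1 - PowerSeries.X ^ e i))
    (hle : CoeffLE (hilbertSeries w (Ideal.span (c '' s))) G) :
    hilbertSeries w (Ideal.span (c '' s)) = G := by
  refine hle.eq_of_mul (zero_coeffLE_prod_geomSeries s e) (coeff_zero_prod_geomSeries s e) ?_
  have h : G * ∏ i ∈ s, geomSeries (e i) = ∏ i, geomSeries (w i) := by
    linear_combination (∏ i ∈ s, geomSeries (e i)) * (∏ i, geomSeries (w i)) * hG -
      G * (∏ i ∈ s, geomSeries (e i)) * prod_geomSeries_mul Finset.univ hw +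
      (∏ i, geomSeries (w i)) * prod_geomSeries_mul s he
  rw [h]
  exact (prod_geomSeries_coeffLE_hilbertSeries_bot hw).trans
    (hilbertSeries_bot_coeffLE hw he hc s)

end HilbertSeries

/-- The Hilbert polynomial of the quotient by `zetaIdeal k m`, defined by a recursion of
Pascal type. -/
noncomputable def zetaPoly : ℕ → ℕ → Polynomial ℤ
  | 0, _ => 1
  | _ + 1, 0 => 1
  | k + 1, m + 1 =>
      (∑ j ∈ Finset.range (2 ^ (k + 1)), (Polynomial.X ^ (2 ^ (m + 1) - 1)) ^ j) *
        zetaPoly (k + 1) m +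
      (Polynomial.X ^ (2 ^ (m + 1) - 1)) ^ 2 ^ (k + 1) * zetaPoly k (m + 1)

lemma two_pow_mul_sub_one_add (a b : ℕ) :
    (2 ^ a - 1) * 2 ^ b + (2 ^ b - 1) = 2 ^ (a + b) - 1 := by
  obtain ⟨x, hx⟩ : ∃ x, 2 ^ a = x + 1 := Nat.exists_eq_add_one.mpr (Nat.two_pow_pos a)
  obtain ⟨y, hy⟩ : ∃ y, 2 ^ b = y + 1 := Nat.exists_eq_add_one.mpr (Nat.two_pow_pos b)
  rw [pow_add, hx, hy]
  simp only [Nat.add_sub_cancel]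
  rw [show (x + 1) * (y + 1) = x * (y + 1) + y + 1 by ring, Nat.add_sub_cancel]

theorem zetaPoly_mul (k m : ℕ) :
    zetaPoly k m * ∏ i ∈ Finset.range k, (1 - Polynomial.X ^ (2 ^ (i + 1) - 1)) =
      ∏ i ∈ Finset.range k, (1 - Polynomial.X ^ (2 ^ (m + i + 1) - 1)) := by
  induction k generalizing m with
  | zero => simp [zetaPoly]
  | succ k ihk =>
    induction m with
    | zero => simp [zetaPoly]
    | succ m ihm =>
      have h1 : ∏ i ∈ Finset.range (k + 1),
          (1 - (Polynomial.X : Polynomial ℤ) ^ (2 ^ (m + i + 1) - 1)) =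
          (∏ i ∈ Finset.range k, (1 - Polynomial.X ^ (2 ^ (m + 1 + i + 1) - 1))) *
            (1 - Polynomial.X ^ (2 ^ (m + 1) - 1)) := by
        rw [Finset.prod_range_succ']
        simp only [add_zero, add_comm, add_left_comm]
      have h2 := geom_sum_mul_neg ((Polynomial.X : Polynomial ℤ) ^ (2 ^ (m + 1) - 1)) (2 ^ (k + 1))
      have h3 : (Polynomial.X : Polynomial ℤ) ^ (2 ^ (m + 1 + k + 1) - 1) =
          (Polynomial.X ^ (2 ^ (m + 1) - 1)) ^ 2 ^ (k + 1) * Polynomial.X ^ (2 ^ (k + 1) - 1) := by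
        rw [← pow_mul, ← pow_add, two_pow_mul_sub_one_add, add_assoc (m + 1)]
      have h4 := ihk (m + 1)
      rw [h1] at ihm
      rw [Finset.prod_range_succ] at ihm ⊢
      rw [Finset.prod_range_succ, zetaPoly, h3]
      set S := ∑ j ∈ Finset.range (2 ^ (k + 1)),
        ((Polynomial.X : Polynomial ℤ) ^ (2 ^ (m + 1) - 1)) ^ j
      linear_combination S * ihm + (Polynomial.X ^ (2 ^ (m + 1) - 1)) ^ 2 ^ (k + 1) *
        (1 - Polynomial.X ^ (2 ^ (k + 1) - 1)) * h4 +
        (∏ i ∈ Finset.range k, (1 - Polynomial.X ^ (2 ^ (m + 1 + i + 1) - 1))) * h2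

lemma natDegree_one_sub_X_pow (n : ℕ) : (1 - (Polynomial.X : Polynomial ℤ) ^ n).natDegree = n := by
  rw [← Polynomial.natDegree_neg, neg_sub, ← Polynomial.C_1, Polynomial.natDegree_X_pow_sub_C]

lemma one_sub_X_pow_ne_zero {n : ℕ} (hn : n ≠ 0) : 1 - (Polynomial.X : Polynomial ℤ) ^ n ≠ 0 :=
  fun h => hn (by rw [← natDegree_one_sub_X_pow n, h, Polynomial.natDegree_zero])

lemma two_pow_succ_sub_one_ne_zero (n : ℕ) : 2 ^ (n + 1) - 1 ≠ 0 := by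
  have := Nat.one_lt_two_pow (n := n + 1) (by omega)
  omega

lemma sum_two_pow_sub_one (k m : ℕ) : ∑ i ∈ Finset.range k, (2 ^ (m + i + 1) - 1) =
    2 * (2 ^ m - 1) * (2 ^ k - 1) + ∑ i ∈ Finset.range k, (2 ^ (i + 1) - 1) := by
  induction k with
  | zero => simp
  | succ k ih =>
    rw [Finset.sum_range_succ, Finset.sum_range_succ, ih]
    obtain ⟨x, hx⟩ : ∃ x, 2 ^ m = x + 1 := Nat.exists_eq_add_one.mpr (Nat.two_pow_pos m)
    obtain ⟨y, hy⟩ : ∃ y, 2 ^ k = y + 1 := Nat.exists_eq_add_one.mpr (Nat.two_pow_pos k)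
    rw [pow_succ, pow_succ, pow_add, hx, hy]
    have h1 : (x + 1) * (y + 1) * 2 - 1 = 2 * x * y + 2 * x + 2 * y + 1 := by
      rw [Nat.sub_eq_iff_eq_add (by nlinarith)]; ring
    have h2 : (y + 1) * 2 - 1 = 2 * y + 1 := by omega
    rw [h1, h2]
    simp only [Nat.add_sub_cancel]
    ring

theorem natDegree_zetaPoly (k m : ℕ) :
    (zetaPoly k m).natDegree = 2 * (2 ^ m - 1) * (2 ^ k - 1) := by
  have hne : ∀ m, ∏ i ∈ Finset.range k,
      (1 - (Polynomial.X : Polynomial ℤ) ^ (2 ^ (m + i + 1) - 1)) ≠ 0 := fun m =>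
    Finset.prod_ne_zero_iff.mpr fun i _ => one_sub_X_pow_ne_zero (two_pow_succ_sub_one_ne_zero _)
  have hdeg : ∀ m, (∏ i ∈ Finset.range k,
      (1 - (Polynomial.X : Polynomial ℤ) ^ (2 ^ (m + i + 1) - 1))).natDegree =
      ∑ i ∈ Finset.range k, (2 ^ (m + i + 1) - 1) := fun m => by
    rw [Polynomial.natDegree_prod _ _ fun i _ =>
      one_sub_X_pow_ne_zero (two_pow_succ_sub_one_ne_zero _)]
    simp only [natDegree_one_sub_X_pow]
  have h := zetaPoly_mul k m
  have hG : zetaPoly k m ≠ 0 := fun h0 => hne m (by rw [← h, h0, zero_mul])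
  have h0 := hne 0
  have hd0 := hdeg 0
  simp only [zero_add] at h0 hd0
  have := congrArg Polynomial.natDegree h
  rw [Polynomial.natDegree_mul hG h0, hd0, hdeg, sum_two_pow_sub_one] at this
  omega

/-- The weight of `A⟨k⟩`: the variable `X i` has weight `2 ^ (i + 1) - 1`. -/
def xiWeight (k : ℕ) (i : Fin k) : ℕ := 2 ^ ((i : ℕ) + 1) - 1

lemma xiWeight_ne_zero {k : ℕ} (i : Fin k) : xiWeight k i ≠ 0 := two_pow_succ_sub_one_ne_zero _

/-- The image of the variable `X i` in `A⟨k⟩`. -/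
noncomputable def xiBar (k i : ℕ) : MvPolynomial (Fin k) (ZMod 2) :=
  if h : i < k then X ⟨i, h⟩ else 0

lemma proj_X (k i : ℕ) : proj k (X i) = xiBar k i := by rw [proj, aeval_X, xiBar]

lemma xiBar_of_lt {k i : ℕ} (h : i < k) : xiBar k i = X ⟨i, h⟩ := dif_pos h

lemma xiBar_of_le {k i : ℕ} (h : k ≤ i) : xiBar k i = 0 := dif_neg h.not_gt

lemma zetaBar_zero (k : ℕ) : zetaBar k 0 = 1 := by rw [zetaBar, zeta, map_one]

lemma zetaBar_succ (k n : ℕ) : zetaBar k (n + 1) =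
    ∑ i ∈ Finset.range (n + 1), xiBar k i ^ 2 ^ (n - i) * zetaBar k (n - i) := by
  rw [zetaBar, zeta, map_sum]
  exact Finset.sum_congr rfl fun i _ => by rw [map_mul, map_pow, proj_X, zetaBar]

/-- The conjugate form of Milnor's recursion. -/
theorem zetaBar_succ' (k n : ℕ) : zetaBar k (n + 1) =
    ∑ j ∈ Finset.range (n + 1), zetaBar k (n - j) ^ 2 ^ (j + 1) * xiBar k j := by
  induction n using Nat.strong_induction_on with
  | _ n ih =>
  rw [Finset.sum_range_succ, zetaBar_succ, Finset.sum_range_succ]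
  simp only [Nat.sub_self, pow_zero, pow_one, zetaBar_zero, one_pow, mul_one, one_mul]
  congr 1
  have h1 : ∀ i ∈ Finset.range n, xiBar k i ^ 2 ^ (n - i) * zetaBar k (n - i) =
      ∑ j ∈ Finset.range (n - i),
        xiBar k i ^ 2 ^ (n - i) * (zetaBar k (n - i - 1 - j) ^ 2 ^ (j + 1) * xiBar k j) := by
    intro i hi
    have hi := Finset.mem_range.mp hi
    obtain ⟨l, hl⟩ : ∃ l, n - i = l + 1 := ⟨n - i - 1, by omega⟩
    rw [← Finset.mul_sum, hl, ih l (by omega), Nat.add_sub_cancel]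
  have h2 : ∀ j ∈ Finset.range n, zetaBar k (n - j) ^ 2 ^ (j + 1) * xiBar k j =
      ∑ i ∈ Finset.range (n - j),
        xiBar k i ^ 2 ^ (n - i) * (zetaBar k (n - i - 1 - j) ^ 2 ^ (j + 1) * xiBar k j) := by
    intro j hj
    have hj := Finset.mem_range.mp hj
    obtain ⟨l, hl⟩ : ∃ l, n - j = l + 1 := ⟨n - j - 1, by omega⟩
    rw [hl, zetaBar_succ, sum_pow_char_pow, Finset.sum_mul]
    refine Finset.sum_congr rfl fun i hi => ?_
    have hi := Finset.mem_range.mp hi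
    rw [mul_pow, ← pow_mul, ← pow_add, show l - i + (j + 1) = n - i by omega,
      show n - i - 1 - j = l - i by omega, mul_assoc]
  rw [Finset.sum_congr rfl h1, Finset.sum_congr rfl h2]
  refine Finset.sum_comm' fun i j => ?_
  simp only [Finset.mem_range]
  omega

lemma isWeightedHomogeneous_xiBar (k i : ℕ) :
    IsWeightedHomogeneous (xiWeight k) (xiBar k i) (2 ^ (i + 1) - 1) := by
  rw [xiBar]
  split_ifs with h
  · exact isWeightedHomogeneous_X _ _ _
  · exact isWeightedHomogeneous_zero _ _ _

theorem isWeightedHomogeneous_zetaBar (k n : ℕ) :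
    IsWeightedHomogeneous (xiWeight k) (zetaBar k n) (2 ^ n - 1) := by
  induction n using Nat.strong_induction_on with
  | _ n ih =>
  cases n with
  | zero => rw [zetaBar_zero]; exact isWeightedHomogeneous_one _ _
  | succ n =>
    rw [zetaBar_succ]
    refine IsWeightedHomogeneous.sum _ _ _ fun i hi => ?_
    have hi := Finset.mem_range.mp hi
    have h := ((isWeightedHomogeneous_xiBar k i).pow (2 ^ (n - i))).mul (ih (n - i) (by omega))
    rwa [smul_eq_mul, mul_comm (2 ^ (n - i)), two_pow_mul_sub_one_add,
      show i + 1 + (n - i) = n + 1 by omega] at h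

/-- The ideal `(ζ̄_{m+1}, …, ζ̄_{m+k})` of `A⟨k⟩`. -/
noncomputable def zetaIdeal (k m : ℕ) : Ideal (MvPolynomial (Fin k) (ZMod 2)) :=
  Ideal.span (Set.range fun i : Fin k => zetaBar k (m + 1 + (i : ℕ)))

theorem zetaBar_mem_zetaIdeal {k m n : ℕ} (h : m < n) : zetaBar k n ∈ zetaIdeal k m := by
  induction n using Nat.strong_induction_on with
  | _ n ih =>
  by_cases hn : n ≤ m + k
  · exact Ideal.subset_span ⟨⟨n - (m + 1), by omega⟩, by
      simp only [show m + 1 + (n - (m + 1)) = n by omega]⟩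
  · obtain ⟨l, rfl⟩ : ∃ l, n = l + 1 := ⟨n - 1, by omega⟩
    rw [zetaBar_succ]
    refine sum_mem fun i _ => ?_
    by_cases hi : i < k
    · exact Ideal.mul_mem_left _ _ (ih _ (by omega) (by omega))
    · rw [xiBar_of_le (not_lt.mp hi), zero_pow (Nat.two_pow_pos _).ne', zero_mul]
      exact zero_mem _

theorem X_mem_zetaIdeal_zero {k : ℕ} (i : Fin k) : X i ∈ zetaIdeal k 0 := by
  have h := zetaBar_succ k i
  rw [Finset.sum_range_succ, Nat.sub_self, pow_zero, pow_one, zetaBar_zero, mul_one,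
    xiBar_of_lt i.isLt] at h
  rw [← sub_eq_iff_eq_add'.mpr h]
  refine sub_mem (zetaBar_mem_zetaIdeal (Nat.succ_pos _)) (sum_mem fun j hj => ?_)
  have hj := Finset.mem_range.mp hj
  exact Ideal.mul_mem_left _ _ (zetaBar_mem_zetaIdeal (by omega))

theorem isWeightedHomogeneous_aeval {R σ τ : Type*} [CommSemiring R] {w : σ → ℕ} {v : τ → ℕ}
    {x : σ → MvPolynomial τ R} (hx : ∀ i, IsWeightedHomogeneous v (x i) (w i))
    {f : MvPolynomial σ R} {d : ℕ} (hf : IsWeightedHomogeneous w f d) :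
    IsWeightedHomogeneous v (aeval x f) d := by
  rw [aeval_def, eval₂_eq]
  refine IsWeightedHomogeneous.sum _ _ _ fun n hn => ?_
  rw [algebraMap_eq]
  refine IsWeightedHomogeneous.C_mul ?_ _
  rw [← hf (mem_support_iff.mp hn), Finsupp.weight_apply]
  exact IsWeightedHomogeneous.prod _ _ _ fun i _ => (hx i).pow _

theorem hilbertSeries_sup_X_last_coeffLE (k m : ℕ) :
    CoeffLE (hilbertSeries (xiWeight (k + 1))
      (Ideal.span (Set.range fun i : Fin k => zetaBar (k + 1) (m + 1 + (i : ℕ))) ⊔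
        Ideal.span {X (Fin.last k)})) (hilbertSeries (xiWeight k) (zetaIdeal k m)) := by
  set L : Ideal (MvPolynomial (Fin (k + 1)) (ZMod 2)) := Ideal.span {X (Fin.last k)}
  have hXL : X (Fin.last k) ∈ L := Ideal.mem_span_singleton_self _
  let φ : MvPolynomial (Fin k) (ZMod 2) →ₐ[ZMod 2] MvPolynomial (Fin (k + 1)) (ZMod 2) :=
    rename Fin.castSucc
  have hζ : ∀ n, φ (zetaBar k n) - zetaBar (k + 1) n ∈ L := fun n => by
    rw [← Ideal.Quotient.eq]
    have : ((Ideal.Quotient.mkₐ (ZMod 2) L).comp φ).comp (proj k) =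
        (Ideal.Quotient.mkₐ (ZMod 2) L).comp (proj (k + 1)) := by
      ext i
      refine Ideal.Quotient.eq.mpr ?_
      change φ (proj k (X i)) - proj (k + 1) (X i) ∈ L
      rw [proj_X, proj_X]
      rcases lt_trichotomy i k with h | rfl | h
      · rw [xiBar_of_lt h, xiBar_of_lt (h.trans (Nat.lt_succ_self k)), rename_X]
        exact (congrArg (· ∈ L) (sub_self (X _))).mpr (zero_mem L)
      · rw [xiBar_of_le le_rfl, xiBar_of_lt (Nat.lt_succ_self i), map_zero, zero_sub]
        exact neg_mem hXL
      · rw [xiBar_of_le h.le, xiBar_of_le h, map_zero, sub_zero]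
        exact zero_mem _
    exact DFunLike.congr_fun this (zeta n)
  let π : MvPolynomial (Fin (k + 1)) (ZMod 2) →ₐ[ZMod 2] MvPolynomial (Fin k) (ZMod 2) :=
    aeval (Fin.lastCases 0 X)
  have hπ : ∀ f, f - φ (π f) ∈ L := fun f => by
    rw [← Ideal.Quotient.eq]
    have : Ideal.Quotient.mkₐ (ZMod 2) L =
        ((Ideal.Quotient.mkₐ (ZMod 2) L).comp φ).comp π := by
      ext i
      refine Ideal.Quotient.eq.mpr ?_
      change X i - φ (π (X i)) ∈ L
      rw [aeval_X]
      induction i using Fin.lastCases with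
      | last => simpa using hXL
      | cast i => simp [φ]
    exact DFunLike.congr_fun this f
  refine hilbertSeries_coeffLE_of_algHom xiWeight_ne_zero φ ?_ fun d f hf =>
    ⟨π f, isWeightedHomogeneous_aeval (fun i => ?_) hf, Ideal.mem_sup_right (hπ f)⟩
  · refine Ideal.span_le.mpr ?_
    rintro _ ⟨i, rfl⟩
    rw [SetLike.mem_coe, Ideal.mem_comap]
    rw [← sub_add_cancel (φ (zetaBar k (m + 1 + i))) (zetaBar (k + 1) (m + 1 + i))]
    exact add_mem (Ideal.mem_sup_right (hζ _)) (Ideal.mem_sup_left (Ideal.subset_span ⟨i, rfl⟩))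
  · induction i using Fin.lastCases with
    | last => simpa using isWeightedHomogeneous_zero _ _ _
    | cast i => simpa [xiWeight] using isWeightedHomogeneous_X (ZMod 2) (xiWeight k) i

section ZetaIdeal

attribute [local instance] MvPolynomial.weightedGradedAlgebra

theorem isHomogeneous_zetaIdeal (k m : ℕ) :
    (zetaIdeal k m).IsHomogeneous (weightedHomogeneousSubmodule (ZMod 2) (xiWeight k)) := by
  refine Ideal.homogeneous_span _ _ ?_
  rintro _ ⟨i, rfl⟩
  exact ⟨_, isWeightedHomogeneous_zetaBar k _⟩

lemma zetaBar_mul_mem_of_mem_zetaIdeal {k m : ℕ} {f : MvPolynomial (Fin k) (ZMod 2)}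
    (hf : f ∈ zetaIdeal k m) (r : ℕ) : zetaBar k (m + 1) ^ r * f ∈
      zetaIdeal k (m + 1) ⊔ Ideal.span {zetaBar k (m + 1) ^ (r + 1)} := by
  set J := zetaIdeal k (m + 1) ⊔ Ideal.span {zetaBar k (m + 1) ^ (r + 1)}
  have hle : zetaIdeal k m ≤
      Submodule.comap
        (LinearMap.mulLeft (MvPolynomial (Fin k) (ZMod 2)) (zetaBar k (m + 1) ^ r)) J := by
    refine Ideal.span_le.mpr ?_
    rintro _ ⟨i, rfl⟩
    change zetaBar k (m + 1) ^ r * zetaBar k (m + 1 + i) ∈ J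
    rcases Nat.eq_zero_or_pos (i : ℕ) with hi | hi
    · rw [hi, add_zero, ← pow_succ]
      exact Ideal.mem_sup_right (Ideal.mem_span_singleton_self _)
    · exact Ideal.mul_mem_left _ _ (Ideal.mem_sup_left (zetaBar_mem_zetaIdeal (by omega)))
  exact hle hf

theorem hilbertSeries_sup_zetaBar_pow_coeffLE (k m r : ℕ) :
    CoeffLE (hilbertSeries (xiWeight k)
      (zetaIdeal k (m + 1) ⊔ Ideal.span {zetaBar k (m + 1) ^ r}))
      ((∑ j ∈ Finset.range r, (PowerSeries.X ^ (2 ^ (m + 1) - 1)) ^ j) *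
        hilbertSeries (xiWeight k) (zetaIdeal k m)) := by
  induction r with
  | zero =>
    rw [pow_zero, Ideal.span_singleton_one, sup_top_eq, hilbertSeries_top, Finset.range_zero,
      Finset.sum_empty, zero_mul]
    exact CoeffLE.refl _
  | succ r ih =>
    have hc (r : ℕ) := (isWeightedHomogeneous_zetaBar k (m + 1)).pow r
    have hhom : (zetaIdeal k (m + 1) ⊔ Ideal.span {zetaBar k (m + 1) ^ (r + 1)}).IsHomogeneous
        (weightedHomogeneousSubmodule (ZMod 2) (xiWeight k)) := by
      refine (isHomogeneous_zetaIdeal k (m + 1)).sup (Ideal.homogeneous_span _ _ ?_)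
      rintro _ rfl
      exact ⟨_, hc (r + 1)⟩
    have h := hilbertSeries_coeffLE_add xiWeight_ne_zero hhom (hc r)
      (L := zetaIdeal k (m + 1) ⊔ Ideal.span {zetaBar k (m + 1) ^ r})
      (sup_le_sup_left (Ideal.span_singleton_le_span_singleton.mpr (pow_dvd_pow _ r.le_succ)) _)
      (sup_le_sup_right le_sup_left _) (fun f hf => zetaBar_mul_mem_of_mem_zetaIdeal hf r)
    refine h.trans ?_
    rw [Finset.sum_range_succ, add_mul, ← pow_mul, smul_eq_mul, mul_comm r]
    exact ih.add (CoeffLE.refl _)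

lemma zetaBar_pow_mul_mem_zetaIdeal {k m : ℕ} {f : MvPolynomial (Fin (k + 1)) (ZMod 2)}
    (hf : f ∈ Ideal.span (Set.range fun i : Fin k => zetaBar (k + 1) (m + 1 + 1 + (i : ℕ))) ⊔
      Ideal.span {X (Fin.last k)}) :
    zetaBar (k + 1) (m + 1) ^ 2 ^ (k + 1) * f ∈ zetaIdeal (k + 1) (m + 1) := by
  obtain ⟨a, ha, b, hb, rfl⟩ := Submodule.mem_sup.mp hf
  obtain ⟨g, rfl⟩ := Ideal.mem_span_singleton'.mp hb
  have ha' : a ∈ zetaIdeal (k + 1) (m + 1) := by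
    refine Ideal.span_le.mpr ?_ ha
    rintro _ ⟨i, rfl⟩
    exact zetaBar_mem_zetaIdeal (by omega)
  rw [mul_add, mul_left_comm]
  refine add_mem (Ideal.mul_mem_left _ _ ha') (Ideal.mul_mem_left _ _ ?_)
  have h := zetaBar_succ' (k + 1) (m + 1 + k)
  have hmem : k ∈ Finset.range (m + 1 + k + 1) := Finset.mem_range.mpr (by omega)
  rw [← Finset.add_sum_erase _ _ hmem, Nat.add_sub_cancel, xiBar_of_lt (Nat.lt_succ_self k)] at h
  change zetaBar (k + 1) (m + 1) ^ 2 ^ (k + 1) * X ⟨k, Nat.lt_succ_self k⟩ ∈ _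
  rw [← sub_eq_iff_eq_add.mpr h]
  refine sub_mem (zetaBar_mem_zetaIdeal (by omega)) (sum_mem fun j hj => ?_)
  have hjk := Finset.ne_of_mem_erase hj
  rcases lt_or_gt_of_ne hjk with hlt | hgt
  · exact Ideal.mul_mem_right _ _ (Ideal.pow_mem_of_mem _ (zetaBar_mem_zetaIdeal (by omega)) _
      (Nat.two_pow_pos _))
  · rw [xiBar_of_le hgt, mul_zero]
    exact zero_mem _

theorem hilbertSeries_zetaIdeal_coeffLE (k m : ℕ) :
    CoeffLE (hilbertSeries (xiWeight k) (zetaIdeal k m)) (zetaPoly k m : PowerSeries ℤ) := by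
  induction k generalizing m with
  | zero =>
    rw [zetaPoly, Polynomial.coe_one]
    exact hilbertSeries_coeffLE_one fun i => i.elim0
  | succ k ihk =>
    induction m with
    | zero =>
      rw [zetaPoly, Polynomial.coe_one]
      exact hilbertSeries_coeffLE_one X_mem_zetaIdeal_zero
    | succ m ihm =>
      have hc := (isWeightedHomogeneous_zetaBar (k + 1) (m + 1)).pow (2 ^ (k + 1))
      have h := hilbertSeries_coeffLE_add xiWeight_ne_zero (isHomogeneous_zetaIdeal (k + 1) (m + 1))
        hc le_sup_left le_rfl fun f hf => zetaBar_pow_mul_mem_zetaIdeal hf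
      refine h.trans ?_
      rw [smul_eq_mul, mul_comm (2 ^ (k + 1)), pow_mul, zetaPoly, Polynomial.coe_add,
        Polynomial.coe_mul, Polynomial.coe_mul, Polynomial.coe_pow, Polynomial.coe_pow,
        Polynomial.coe_X, ← Polynomial.coeToPowerSeries.ringHom_apply (φ := Finset.sum _ _),
        map_sum]
      simp only [map_pow, Polynomial.coeToPowerSeries.ringHom_apply, Polynomial.coe_X]
      refine ((hilbertSeries_sup_zetaBar_pow_coeffLE (k + 1) m (2 ^ (k + 1))).trans
        (ihm.mul_left fun d => ?_)).add
        (((hilbertSeries_sup_X_last_coeffLE k (m + 1)).trans (ihk (m + 1))).mul_left ?_)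
      · rw [map_sum, map_zero]
        exact Finset.sum_nonneg fun j _ => by
          rw [← pow_mul]; exact CoeffLE.zero_X_pow _ d
      · rw [← pow_mul]; exact CoeffLE.zero_X_pow _

theorem hilbertSeries_zetaIdeal (k m : ℕ) :
    hilbertSeries (xiWeight k) (zetaIdeal k m) = (zetaPoly k m : PowerSeries ℤ) := by
  have himage : zetaIdeal k m = Ideal.span ((fun i : Fin k => zetaBar k (m + 1 + (i : ℕ))) ''
      ((Finset.univ : Finset (Fin k)) : Set (Fin k))) := by
    rw [Finset.coe_univ, Set.image_univ, zetaIdeal]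
  have hG : (zetaPoly k m : PowerSeries ℤ) * ∏ i, (1 - PowerSeries.X ^ xiWeight k i) =
      ∏ i : Fin k, (1 - PowerSeries.X ^ (2 ^ (m + 1 + (i : ℕ)) - 1)) := by
    have h := congrArg Polynomial.coeToPowerSeries.ringHom (zetaPoly_mul k m)
    simp only [map_mul, map_prod, map_sub, map_one, map_pow,
      Polynomial.coeToPowerSeries.ringHom_apply, Polynomial.coe_X, Finset.prod_range] at h
    simp only [xiWeight, add_right_comm m 1]
    exact h
  have hle := hilbertSeries_zetaIdeal_coeffLE k m
  rw [himage] at hle ⊢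
  exact hilbertSeries_eq_of_coeffLE xiWeight_ne_zero
    (fun i => by rw [add_right_comm]; exact two_pow_succ_sub_one_ne_zero _)
    (fun i => isWeightedHomogeneous_zetaBar k _) _ hG hle

end ZetaIdeal

/-- STATEMENT 8: Hilbert series of `A⟨k⟩/(ζ̄_{m+1}, …, ζ̄_{m+k})`.  With `ξ_{i}`
(the variable `X (i-1)`) of weighted degree `2^i − 1`, let `h d` be the
`F₂`-dimension of the degree-`d` part of the quotient, i.e. of the image of the
space of weighted-homogeneous polynomials of degree `d`.  Then `h d = 0` for
`d > 2(2^m − 1)(2^k − 1)` and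
`(∑ d, h d • t^d) ⬝ ∏_{i=1}^k (1 − t^{2^i−1}) = ∏_{i=1}^k (1 − t^{2^{m+i}−1})` in `ℤ[t]`. -/
theorem quotient_zetaBar_hilbert_series (k m : ℕ) (hk : 1 ≤ k)
    (w : Fin k → ℕ) (hw : w = fun i : Fin k => 2 ^ ((i : ℕ) + 1) - 1)
    (I : Ideal (MvPolynomial (Fin k) (ZMod 2)))
    (hI : I = Ideal.span (Set.range fun i : Fin k => zetaBar k (m + 1 + (i : ℕ))))
    (h : ℕ → ℕ)
    (hh : ∀ d, h d = Module.finrank (ZMod 2)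
      ((MvPolynomial.weightedHomogeneousSubmodule (ZMod 2) w d).map
        (Ideal.Quotient.mkₐ (ZMod 2) I).toLinearMap)) :
    (∀ d, 2 * (2 ^ m - 1) * (2 ^ k - 1) < d → h d = 0) ∧
    (∑ d ∈ Finset.range (2 * (2 ^ m - 1) * (2 ^ k - 1) + 1),
        Polynomial.C (h d : ℤ) * Polynomial.X ^ d) *
        ∏ i ∈ Finset.range k, (1 - (Polynomial.X : Polynomial ℤ) ^ (2 ^ (i + 1) - 1)) =
      ∏ i ∈ Finset.range k, (1 - (Polynomial.X : Polynomial ℤ) ^ (2 ^ (m + i + 1) - 1)) := by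
  subst hw hI
  have hcoeff : ∀ d, (h d : ℤ) = (zetaPoly k m).coeff d := fun d => by
    rw [hh, ← Polynomial.coeff_coe, ← hilbertSeries_zetaIdeal, hilbertSeries, PowerSeries.coeff_mk]
    rfl
  refine ⟨fun d hd => ?_, ?_⟩
  · rw [← natDegree_zetaPoly] at hd
    exact_mod_cast (hcoeff d).trans (Polynomial.coeff_eq_zero_of_natDegree_lt hd)
  · simp only [hcoeff]
    rw [← Polynomial.as_sum_range_C_mul_X_pow' _
      (Nat.lt_succ_of_le (natDegree_zetaPoly k m).le), zetaPoly_mul]
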